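/- arXiv:1812.11438 — 2 statements merged into one kernel-verified Lean document; each statement's English description precedes it below -/
import Mathlib

section
/- Let α > 0 and δ > 2, and let p : (0,∞) → ℝ be differentiable with p'(ρ) = α·ρ^δ for all ρ > 0. Let ρ_l > 0 and q_l ∈ ℝ satisfy −c(ρ_l) < q_l/ρ_l < −(2/δ)·c(ρ_l) (in particular (ρ_l, q_l) is sub-sonic). Then L_l(ρ; ρ_l, q_l) < 0 for every ρ > 0. -/
open Filter Topology Set MeasureTheory intervalIntegral

/-- A state `(ρ₀, q₀)` is sub-sonic for the pressure law with derivative `p'`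
if `ρ₀ > 0` and `|q₀/ρ₀| < c(ρ₀) = √(p'(ρ₀))`. -/
def SubSonic (p' : ℝ → ℝ) (ρ₀ q₀ : ℝ) : Prop :=
  0 < ρ₀ ∧ |q₀ / ρ₀| < Real.sqrt (p' ρ₀)

/-- The 1-Lax curve through the left state `(ρl, ql)`, for pressure law `p`
with derivative `p'` (acoustic speed `c = √p'`):
rarefaction part for `ρ ≤ ρl`, shock part for `ρ ≥ ρl`, where
`f(ρ, ρl) = (ρ/ρl)(ρ − ρl)(p(ρ) − p(ρl))`. -/
noncomputable def laxL (p p' : ℝ → ℝ) (ρl ql ρ : ℝ) : ℝ :=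
  if ρ ≤ ρl then ρ * (ql / ρl + ∫ s in ρ..ρl, Real.sqrt (p' s) / s)
  else ρ * (ql / ρl) - Real.sqrt (ρ / ρl * (ρ - ρl) * (p ρ - p ρl))

/-- The 2-Lax curve through the right state `(ρr, qr)`. -/
noncomputable def laxR (p p' : ℝ → ℝ) (ρr qr ρ : ℝ) : ℝ :=
  if ρ ≤ ρr then ρ * (qr / ρr - ∫ s in ρ..ρr, Real.sqrt (p' s) / s)
  else ρ * (qr / ρr) + Real.sqrt (ρ / ρr * (ρ - ρr) * (p ρ - p ρr))

/-- The Riemann-invariant integral `∫ c(s)/s ds` for the pressure law `p'(s) = α s^δ`. -/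
theorem integral_sqrt_power_div {α δ a b : ℝ} (hα : 0 ≤ α) (hδ : 0 < δ)
    (ha : 0 < a) (hb : 0 < b) :
    ∫ s in a..b, Real.sqrt (α * s ^ δ) / s =
      2 / δ * (Real.sqrt (α * b ^ δ) - Real.sqrt (α * a ^ δ)) := by
  have hsqrt : ∀ s : ℝ, 0 < s → Real.sqrt (α * s ^ δ) = Real.sqrt α * s ^ (δ / 2) := by
    intro s hs
    rw [Real.sqrt_mul hα, Real.sqrt_eq_rpow (s ^ δ), ← Real.rpow_mul hs.le, mul_one_div]
  have hcongr : ∫ s in a..b, Real.sqrt (α * s ^ δ) / s =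
      ∫ s in a..b, Real.sqrt α * s ^ (δ / 2 - 1) := by
    refine intervalIntegral.integral_congr fun s hs => ?_
    have hs0 : 0 < s := (lt_min ha hb).trans_le hs.1
    simp only [hsqrt s hs0, Real.rpow_sub_one hs0.ne', mul_div_assoc]
  rw [hcongr, intervalIntegral.integral_const_mul, integral_rpow (Or.inl (by linarith)),
    sub_add_cancel, hsqrt a ha, hsqrt b hb]
  field_simp

/-- For `p'(ρ) = α ρ^δ` with `α > 0`, `δ > 2`, and a sub-sonic
left state with `−c(ρl) < ql/ρl < −(2/δ)·c(ρl)`, the 1-Lax curve is strictly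
negative for all `ρ > 0`. -/
theorem stmt7 (α δ : ℝ) (hα : 0 < α) (hδ : 2 < δ) (p : ℝ → ℝ)
    (hp : ∀ ρ > (0 : ℝ), HasDerivAt p (α * ρ ^ δ) ρ)
    (ρl ql : ℝ) (hρl : 0 < ρl)
    (h1 : -Real.sqrt (α * ρl ^ δ) < ql / ρl)
    (h2 : ql / ρl < -(2 / δ) * Real.sqrt (α * ρl ^ δ)) :
    ∀ ρ > (0 : ℝ), laxL p (fun s => α * s ^ δ) ρl ql ρ < 0 := by
  intro ρ hρ
  have hc : 0 ≤ Real.sqrt (α * ρl ^ δ) := Real.sqrt_nonneg _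
  have hδ' : 0 < 2 / δ := by positivity
  unfold laxL
  split_ifs with h
  · rw [integral_sqrt_power_div hα.le (by linarith) hρ hρl]
    refine mul_neg_of_pos_of_neg hρ ?_
    nlinarith [mul_nonneg hδ'.le (Real.sqrt_nonneg (α * ρ ^ δ))]
  · have hq : ql / ρl < 0 := by nlinarith
    linarith [mul_neg_of_pos_of_neg hρ hq,
      Real.sqrt_nonneg (ρ / ρl * (ρ - ρl) * (p ρ - p ρl))]
end

section
/- Let p : (0,∞) → ℝ be three times continuously differentiable with p'(ρ) > 0 for all ρ > 0 and c(ρ) = √(p'(ρ)), and assume: (C1) 2·p'(ρ) + ρ·p''(ρ) ≥ 0 and 6·p'(ρ) + 6·ρ·p''(ρ) + ρ²·p'''(ρ) ≥ 0 for all ρ > 0; (C2) either (a) p(ρ) → ∞ as ρ → ∞, or (b) p'(ρ) ≤ −p(ρ)/ρ for all ρ > 0; (C3) either (a) there exists p₀ > 0 such that p(ρ) = −p₀/ρ + o(1/ρ) as ρ → 0⁺, or (b) one of the following holds: (i) lim_{ρ→0⁺} c(ρ) = 0 and 2·p'(ρ) − ρ·p''(ρ) ≥ 0 for all ρ > 0;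 (ii) the limit lim_{ρ→0⁺} c(ρ) exists, is finite and strictly positive; (iii) there is η ∈ (0,1) such that lim_{ρ→0⁺} ρ^η·c(ρ) exists, is finite and strictly positive. Then for every pair of sub-sonic states (ρ_l, q_l) and (ρ_r, q_r) there exists a unique ρ > 0 with L_l(ρ; ρ_l, q_l) = L_r(ρ; ρ_r, q_r), i.e. the Riemann problem for the isentropic Euler equations with pressure law p and arbitrary sub-sonic left- and right-hand states is well-posed. -/
open Filter Topology Set MeasureTheory intervalIntegral

/-- The Riemann invariant difference `∫_ρ^{ρ₀} c(s)/s ds` along a rarefaction curve. -/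
noncomputable def rarefaction (p' : ℝ → ℝ) (ρ₀ ρ : ℝ) : ℝ :=
  ∫ s in ρ..ρ₀, Real.sqrt (p' s) / s

/-- The velocity jump across a shock. -/
noncomputable def shock (p : ℝ → ℝ) (ρ₀ ρ : ℝ) : ℝ :=
  Real.sqrt ((1 / ρ₀ - 1 / ρ) * (p ρ - p ρ₀))

/-- The velocity change along a Lax curve: both Lax curves are `ρ * (q₀ / ρ₀ ± laxVel ρ)`. -/
noncomputable def laxVel (p p' : ℝ → ℝ) (ρ₀ ρ : ℝ) : ℝ :=
  rarefaction p' ρ₀ (min ρ ρ₀) - shock p ρ₀ (max ρ ρ₀)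

lemma rarefaction_self (p' : ℝ → ℝ) (ρ₀ : ℝ) : rarefaction p' ρ₀ ρ₀ = 0 := by
  simp [rarefaction]

lemma shock_self (p : ℝ → ℝ) (ρ₀ : ℝ) : shock p ρ₀ ρ₀ = 0 := by
  simp [shock]

lemma laxVel_of_le {p p' : ℝ → ℝ} {ρ₀ ρ : ℝ} (h : ρ ≤ ρ₀) :
    laxVel p p' ρ₀ ρ = rarefaction p' ρ₀ ρ := by
  simp [laxVel, h, shock_self]

lemma laxVel_of_ge {p p' : ℝ → ℝ} {ρ₀ ρ : ℝ} (h : ρ₀ ≤ ρ) :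
    laxVel p p' ρ₀ ρ = -shock p ρ₀ ρ := by
  simp [laxVel, h, rarefaction_self]

lemma sqrt_hugoniot_eq_mul_shock (p : ℝ → ℝ) {ρ₀ ρ : ℝ} (h₀ : 0 < ρ₀) (h : 0 < ρ) :
    Real.sqrt (ρ / ρ₀ * (ρ - ρ₀) * (p ρ - p ρ₀)) = ρ * shock p ρ₀ ρ := by
  have : ρ / ρ₀ * (ρ - ρ₀) * (p ρ - p ρ₀)
      = ρ ^ 2 * ((1 / ρ₀ - 1 / ρ) * (p ρ - p ρ₀)) := by
    field_simp
  rw [this, Real.sqrt_mul (sq_nonneg ρ), Real.sqrt_sq h.le, shock]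

lemma laxL_eq (p p' : ℝ → ℝ) {ρ₀ ρ : ℝ} (q₀ : ℝ) (h₀ : 0 < ρ₀) (h : 0 < ρ) :
    laxL p p' ρ₀ q₀ ρ = ρ * (q₀ / ρ₀ + laxVel p p' ρ₀ ρ) := by
  unfold laxL
  split_ifs with hle
  · rw [laxVel_of_le hle, rarefaction]
  · rw [laxVel_of_ge (not_le.mp hle).le, sqrt_hugoniot_eq_mul_shock p h₀ h]
    ring

lemma laxR_eq (p p' : ℝ → ℝ) {ρ₀ ρ : ℝ} (q₀ : ℝ) (h₀ : 0 < ρ₀) (h : 0 < ρ) :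
    laxR p p' ρ₀ q₀ ρ = ρ * (q₀ / ρ₀ - laxVel p p' ρ₀ ρ) := by
  unfold laxR
  split_ifs with hle
  · rw [laxVel_of_le hle, rarefaction]
  · rw [laxVel_of_ge (not_le.mp hle).le, sqrt_hugoniot_eq_mul_shock p h₀ h]
    ring

/-- A function with nonnegative derivative on `(0, ∞)` is monotone there. -/
lemma monotoneOn_Ioi_of_hasDerivAt {f f' : ℝ → ℝ}
    (hf : ∀ x > (0 : ℝ), HasDerivAt f (f' x) x) (hf' : ∀ x > (0 : ℝ), 0 ≤ f' x) :
    MonotoneOn f (Ioi 0) := by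
  apply monotoneOn_of_deriv_nonneg (convex_Ioi 0)
  · exact fun x hx => (hf x hx).continuousAt.continuousWithinAt
  · rw [interior_Ioi]
    exact fun x hx => (hf x hx).differentiableAt.differentiableWithinAt
  · rw [interior_Ioi]
    intro x hx
    rw [(hf x hx).deriv]
    exact hf' x hx

/-- A function with nonpositive derivative on `(0, b]` is antitone there. -/
lemma antitoneOn_Ioc_of_hasDerivAt {f f' : ℝ → ℝ} {b : ℝ}
    (hf : ∀ x > (0 : ℝ), HasDerivAt f (f' x) x) (hf' : ∀ x ∈ Ioo 0 b, f' x ≤ 0) :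
    AntitoneOn f (Ioc 0 b) := by
  apply antitoneOn_of_deriv_nonpos (convex_Ioc 0 b)
  · exact fun x hx => (hf x hx.1).continuousAt.continuousWithinAt
  · rw [interior_Ioc]
    exact fun x hx => (hf x hx.1).differentiableAt.differentiableWithinAt
  · rw [interior_Ioc]
    intro x hx
    rw [(hf x hx.1).deriv]
    exact hf' x hx

lemma hasDerivAt_rarefaction {p' : ℝ → ℝ} (hc : ContinuousOn p' (Ioi 0)) {ρ₀ ρ : ℝ}
    (h₀ : 0 < ρ₀) (h : 0 < ρ) :
    HasDerivAt (rarefaction p' ρ₀) (-(Real.sqrt (p' ρ) / ρ)) ρ := by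
  have hcont : ContinuousOn (fun s => Real.sqrt (p' s) / s) (Ioi 0) :=
    hc.sqrt.div continuousOn_id fun x hx => (mem_Ioi.mp hx).ne'
  refine integral_hasDerivAt_left ?_ (hcont.stronglyMeasurableAtFilter isOpen_Ioi ρ h)
    (hcont.continuousAt (Ioi_mem_nhds h))
  refine (hcont.mono fun x hx => ?_).intervalIntegrable
  exact (lt_min h h₀).trans_le hx.1

lemma strictAntiOn_rarefaction {p' : ℝ → ℝ} (hc : ContinuousOn p' (Ioi 0))
    (hpos : ∀ ρ > (0 : ℝ), 0 < p' ρ) {ρ₀ : ℝ} (h₀ : 0 < ρ₀) :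
    StrictAntiOn (rarefaction p' ρ₀) (Ioi 0) := by
  apply strictAntiOn_of_deriv_neg (convex_Ioi 0)
  · exact fun x hx => (hasDerivAt_rarefaction hc h₀ hx).continuousAt.continuousWithinAt
  · rw [interior_Ioi]
    intro x hx
    rw [(hasDerivAt_rarefaction hc h₀ hx).deriv, neg_lt_zero]
    exact div_pos (Real.sqrt_pos.mpr (hpos x hx)) hx

lemma strictMonoOn_pressure {p p' : ℝ → ℝ} (hp' : ∀ ρ > (0 : ℝ), HasDerivAt p (p' ρ) ρ)
    (hpos : ∀ ρ > (0 : ℝ), 0 < p' ρ) : StrictMonoOn p (Ioi 0) := by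
  apply strictMonoOn_of_deriv_pos (convex_Ioi 0)
  · exact fun x hx => (hp' x hx).continuousAt.continuousWithinAt
  · rw [interior_Ioi]
    intro x hx
    rw [(hp' x hx).deriv]
    exact hpos x hx

lemma strictMonoOn_shock {p p' : ℝ → ℝ} (hp' : ∀ ρ > (0 : ℝ), HasDerivAt p (p' ρ) ρ)
    (hpos : ∀ ρ > (0 : ℝ), 0 < p' ρ) {ρ₀ : ℝ} (h₀ : 0 < ρ₀) :
    StrictMonoOn (shock p ρ₀) (Ici ρ₀) := by
  intro x hx y hy hxy
  have hx' : 0 < x := h₀.trans_le hx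
  have hmono := strictMonoOn_pressure hp' hpos
  have h1 : 0 ≤ p x - p ρ₀ := sub_nonneg.mpr (hmono.monotoneOn h₀ hx' hx)
  have h2 : p x < p y := hmono hx' (hx'.trans hxy) hxy
  have h3 : 1 / x ≤ 1 / ρ₀ := one_div_le_one_div_of_le h₀ hx
  have h4 : 1 / y < 1 / x := one_div_lt_one_div_of_lt hx' hxy
  apply Real.sqrt_lt_sqrt (mul_nonneg (by linarith) h1)
  exact mul_lt_mul'' (by linarith) (by linarith) (by linarith) h1

lemma strictAntiOn_laxVel {p p' : ℝ → ℝ} (hp' : ∀ ρ > (0 : ℝ), HasDerivAt p (p' ρ) ρ)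
    (hc : ContinuousOn p' (Ioi 0)) (hpos : ∀ ρ > (0 : ℝ), 0 < p' ρ) {ρ₀ : ℝ} (h₀ : 0 < ρ₀) :
    StrictAntiOn (laxVel p p' ρ₀) (Ioi 0) := by
  have hl : StrictAntiOn (laxVel p p' ρ₀) (Ioc 0 ρ₀) :=
    ((strictAntiOn_rarefaction hc hpos h₀).mono fun x hx => hx.1).congr
      fun x hx => (laxVel_of_le hx.2).symm
  have hr : StrictAntiOn (laxVel p p' ρ₀) (Ici ρ₀) := by
    intro x hx y hy hxy
    rw [laxVel_of_ge hx, laxVel_of_ge hy, neg_lt_neg_iff]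
    exact strictMonoOn_shock hp' hpos h₀ hx hy hxy
  have := hl.union hr ⟨⟨h₀, le_rfl⟩, fun x hx => hx.2⟩ isLeast_Ici
  rwa [Ioc_union_Ici_eq_Ioi h₀] at this

lemma continuousOn_laxVel {p p' : ℝ → ℝ} (hp' : ∀ ρ > (0 : ℝ), HasDerivAt p (p' ρ) ρ)
    (hc : ContinuousOn p' (Ioi 0)) {ρ₀ : ℝ} (h₀ : 0 < ρ₀) :
    ContinuousOn (laxVel p p' ρ₀) (Ioi 0) := by
  have hr : ContinuousOn (rarefaction p' ρ₀) (Ioi 0) :=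
    fun x hx => (hasDerivAt_rarefaction hc h₀ hx).continuousAt.continuousWithinAt
  have hp : ContinuousOn p (Ioi 0) := fun x hx => (hp' x hx).continuousAt.continuousWithinAt
  have hs : ContinuousOn (shock p ρ₀) (Ioi 0) :=
    ((continuousOn_const.sub (continuousOn_const.div continuousOn_id
      fun x hx => (mem_Ioi.mp hx).ne')).mul (hp.sub continuousOn_const)).sqrt
  refine (hr.comp (continuous_id.min continuous_const).continuousOn ?_).sub
    (hs.comp (continuous_id.max continuous_const).continuousOn ?_)
  · exact fun x hx => lt_min hx h₀
  · exact fun x hx => lt_max_of_lt_right h₀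

section Bounds

variable {p p' p'' : ℝ → ℝ}

lemma monotoneOn_sq_mul_deriv (hp'' : ∀ ρ > (0 : ℝ), HasDerivAt p' (p'' ρ) ρ)
    (hC1a : ∀ ρ > (0 : ℝ), 0 ≤ 2 * p' ρ + ρ * p'' ρ) :
    MonotoneOn (fun ρ => ρ ^ 2 * p' ρ) (Ioi 0) := by
  refine monotoneOn_Ioi_of_hasDerivAt (f' := fun ρ => ρ * (2 * p' ρ + ρ * p'' ρ)) ?_ ?_
  · intro x hx
    refine (((hasDerivAt_id x).pow 2).mul (hp'' x hx)).congr_deriv ?_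
    simp
    ring
  · exact fun x hx => mul_nonneg hx.le (hC1a x hx)

lemma hasDerivAt_pressure_add_div (hp' : ∀ ρ > (0 : ℝ), HasDerivAt p (p' ρ) ρ) (k : ℝ)
    {x : ℝ} (hx : 0 < x) :
    HasDerivAt (fun ρ => p ρ + k / ρ) ((x ^ 2 * p' x - k) / x ^ 2) x := by
  refine ((hp' x hx).add ((hasDerivAt_const x k).div (hasDerivAt_id x) hx.ne')).congr_deriv ?_
  simp
  field_simp
  ring

lemma le_pressure_sub (hp' : ∀ ρ > (0 : ℝ), HasDerivAt p (p' ρ) ρ)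
    (hm : MonotoneOn (fun ρ => ρ ^ 2 * p' ρ) (Ioi 0)) {a b : ℝ} (ha : 0 < a) (hab : a ≤ b) :
    a ^ 2 * p' a * (1 / a - 1 / b) ≤ p b - p a := by
  have key : MonotoneOn (fun ρ => p ρ + a ^ 2 * p' a / ρ) (Ici a) := by
    have hd := fun x (hx : a ≤ x) =>
      hasDerivAt_pressure_add_div hp' (a ^ 2 * p' a) (ha.trans_le hx)
    apply monotoneOn_of_deriv_nonneg (convex_Ici a)
    · exact fun x hx => (hd x hx).continuousAt.continuousWithinAt
    · rw [interior_Ici]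
      exact fun x hx => (hd x (mem_Ioi.mp hx).le).differentiableAt.differentiableWithinAt
    · rw [interior_Ici]
      intro x hx
      rw [(hd x (mem_Ioi.mp hx).le).deriv]
      exact div_nonneg
        (sub_nonneg.mpr (hm ha (ha.trans hx) (mem_Ioi.mp hx).le)) (sq_nonneg x)
  have := key self_mem_Ici hab hab
  simp only at this
  have e : a ^ 2 * p' a * (1 / a - 1 / b) = a ^ 2 * p' a / a - a ^ 2 * p' a / b := by ring
  linarith

lemma pressure_sub_le (hp' : ∀ ρ > (0 : ℝ), HasDerivAt p (p' ρ) ρ)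
    (hm : MonotoneOn (fun ρ => ρ ^ 2 * p' ρ) (Ioi 0)) {a b : ℝ} (ha : 0 < a) (hab : a ≤ b) :
    p b - p a ≤ b ^ 2 * p' b * (1 / a - 1 / b) := by
  have hb := ha.trans_le hab
  have key : AntitoneOn (fun ρ => p ρ + b ^ 2 * p' b / ρ) (Ioc 0 b) := by
    refine antitoneOn_Ioc_of_hasDerivAt
      (fun x hx => hasDerivAt_pressure_add_div hp' (b ^ 2 * p' b) hx) fun x hx => ?_
    exact div_nonpos_of_nonpos_of_nonneg
      (sub_nonpos.mpr (hm hx.1 hb hx.2.le)) (sq_nonneg x)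
  have := key ⟨ha, hab⟩ ⟨hb, le_rfl⟩ hab
  simp only at this
  have e : b ^ 2 * p' b * (1 / a - 1 / b) = b ^ 2 * p' b / a - b ^ 2 * p' b / b := by ring
  linarith

lemma exists_laxVel_lt_neg (hp' : ∀ ρ > (0 : ℝ), HasDerivAt p (p' ρ) ρ)
    (hpos : ∀ ρ > (0 : ℝ), 0 < p' ρ)
    (hm : MonotoneOn (fun ρ => ρ ^ 2 * p' ρ) (Ioi 0)) {ρ₀ v : ℝ} (h₀ : 0 < ρ₀)
    (hv : v < Real.sqrt (p' ρ₀)) : ∃ ρ : ℝ, 0 < ρ ∧ laxVel p p' ρ₀ ρ < -v := by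
  have hlim : Tendsto (fun ρ : ℝ => (1 - ρ₀ / ρ) * Real.sqrt (p' ρ₀)) atTop
      (𝓝 ((1 - 0) * Real.sqrt (p' ρ₀))) :=
    (tendsto_const_nhds.sub (tendsto_const_nhds.div_atTop tendsto_id)).mul_const _
  rw [sub_zero, one_mul] at hlim
  obtain ⟨ρ, hρv, hρ⟩ := ((hlim.eventually_const_lt hv).and (eventually_ge_atTop ρ₀)).exists
  have hρ0 : 0 < ρ := h₀.trans_le hρ
  refine ⟨ρ, hρ0, ?_⟩
  rw [laxVel_of_ge hρ, neg_lt_neg_iff]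
  refine hρv.trans_le (Real.le_sqrt_of_sq_le ?_)
  rw [mul_pow, Real.sq_sqrt (hpos ρ₀ h₀).le]
  have h1 : 0 ≤ 1 / ρ₀ - 1 / ρ := sub_nonneg.mpr (one_div_le_one_div_of_le h₀ hρ)
  calc (1 - ρ₀ / ρ) ^ 2 * p' ρ₀
      = (1 / ρ₀ - 1 / ρ) * (ρ₀ ^ 2 * p' ρ₀ * (1 / ρ₀ - 1 / ρ)) := by field_simp
    _ ≤ _ := mul_le_mul_of_nonneg_left (le_pressure_sub hp' hm h₀ hρ) h1

/-- If the acoustic speed is bounded below near the vacuum, the rarefaction curve is unbounded. -/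
lemma exists_lt_laxVel_of_le_sqrt (hc : ContinuousOn p' (Ioi 0)) {k ρ₀ : ℝ} (hk : 0 < k)
    (hkc : ∀ᶠ ρ in 𝓝[>] (0 : ℝ), k ≤ Real.sqrt (p' ρ)) (h₀ : 0 < ρ₀) (v : ℝ) :
    ∃ ρ : ℝ, 0 < ρ ∧ v < laxVel p p' ρ₀ ρ := by
  obtain ⟨δ, hδ, hsub⟩ := mem_nhdsGT_iff_exists_Ioo_subset.mp hkc
  have hd : ∀ x > (0 : ℝ), HasDerivAt (fun ρ => rarefaction p' ρ₀ ρ + k * Real.log ρ)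
      (-(Real.sqrt (p' x) / x) + k * x⁻¹) x := fun x hx =>
    (hasDerivAt_rarefaction hc h₀ hx).add ((Real.hasDerivAt_log hx.ne').const_mul k)
  have hanti := antitoneOn_Ioc_of_hasDerivAt (b := δ) hd fun x hx => by
    have : k * x⁻¹ ≤ Real.sqrt (p' x) * x⁻¹ :=
      mul_le_mul_of_nonneg_right (hsub hx) (inv_nonneg.mpr hx.1.le)
    rw [div_eq_mul_inv]
    linarith
  have hlog : Tendsto (fun ρ => k * Real.log ρ) (𝓝[>] 0) atBot :=
    Real.tendsto_log_nhdsGT_zero.const_mul_atBot hk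
  obtain ⟨ρ, hρv, hρδ, hρ0⟩ := ((hlog.eventually_lt_atBot
    (rarefaction p' ρ₀ δ + k * Real.log δ - v)).and
    ((show ∀ᶠ ρ in 𝓝[>] (0 : ℝ), ρ ∈ Ioo 0 δ from Ioo_mem_nhdsGT (mem_Ioi.mp hδ)).and
    (Ioo_mem_nhdsGT h₀))).exists
  refine ⟨ρ, hρ0.1, ?_⟩
  rw [laxVel_of_le hρ0.2.le]
  have := hanti ⟨hρδ.1, hρδ.2.le⟩ ⟨hδ, le_rfl⟩ hρδ.2.le
  simp only at this
  linarith

lemma exists_lt_laxVel_of_tendsto_zero (hp'' : ∀ ρ > (0 : ℝ), HasDerivAt p' (p'' ρ) ρ)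
    (hc : ContinuousOn p' (Ioi 0)) (hpos : ∀ ρ > (0 : ℝ), 0 < p' ρ)
    (hlim : Tendsto (fun ρ => Real.sqrt (p' ρ)) (𝓝[>] (0 : ℝ)) (𝓝 0))
    (hle : ∀ ρ > (0 : ℝ), 0 ≤ 2 * p' ρ - ρ * p'' ρ) {ρ₀ v : ℝ} (h₀ : 0 < ρ₀)
    (hv : v < Real.sqrt (p' ρ₀)) : ∃ ρ : ℝ, 0 < ρ ∧ v < laxVel p p' ρ₀ ρ := by
  have hd : ∀ x > (0 : ℝ), HasDerivAt (fun ρ => rarefaction p' ρ₀ ρ + Real.sqrt (p' ρ))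
      (-(Real.sqrt (p' x) / x) + p'' x / (2 * Real.sqrt (p' x))) x := fun x hx =>
    (hasDerivAt_rarefaction hc h₀ hx).add ((hp'' x hx).sqrt (hpos x hx).ne')
  have hanti := antitoneOn_Ioc_of_hasDerivAt (b := ρ₀) hd fun x hx => by
    have hs := Real.sqrt_pos.mpr (hpos x hx.1)
    have hx0 := hx.1
    rw [neg_add_nonpos_iff, div_le_div_iff₀ (by positivity) hx0]
    have h2 := Real.mul_self_sqrt (hpos x hx0).le
    have h3 := hle x hx0
    linarith
  obtain ⟨ρ, hρv, hρ⟩ := ((hlim.eventually_lt_const (sub_pos.mpr hv)).and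
    (Ioo_mem_nhdsGT h₀)).exists
  refine ⟨ρ, hρ.1, ?_⟩
  rw [laxVel_of_le hρ.2.le]
  have := hanti ⟨hρ.1, hρ.2.le⟩ ⟨h₀, le_rfl⟩ hρ.2.le
  simp only [rarefaction_self] at this
  linarith

/-- If `p(ρ) = -p₀/ρ + o(1/ρ)` at the vacuum, then `p'(ρ) ≥ p₀/ρ²`. -/
lemma le_sq_mul_deriv_of_isLittleO (hp' : ∀ ρ > (0 : ℝ), HasDerivAt p (p' ρ) ρ)
    (hm : MonotoneOn (fun ρ => ρ ^ 2 * p' ρ) (Ioi 0)) {p₀ : ℝ}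
    (ho : (fun ρ => p ρ - (-p₀ / ρ)) =o[𝓝[>] (0 : ℝ)] fun ρ => 1 / ρ) {r : ℝ} (hr : 0 < r) :
    p₀ ≤ r ^ 2 * p' r := by
  have h1 := ho.tendsto_div_nhds_zero
  have hid : Tendsto (fun ρ : ℝ => ρ) (𝓝[>] 0) (𝓝 0) := nhdsWithin_le_nhds
  have h2 : Tendsto (fun ρ => (p r + r ^ 2 * p' r * (1 / r)) * ρ + p₀ - r ^ 2 * p' r)
      (𝓝[>] 0) (𝓝 ((p r + r ^ 2 * p' r * (1 / r)) * 0 + p₀ - r ^ 2 * p' r)) :=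
    ((hid.const_mul _).add_const _).sub_const _
  have h3 := le_of_tendsto_of_tendsto h2 h1 (by
    filter_upwards [Ioo_mem_nhdsGT hr] with ρ hρ
    have hρ0 := hρ.1
    have h4 := mul_le_mul_of_nonneg_right (pressure_sub_le hp' hm hρ0 hρ.2.le) hρ0.le
    have e1 : r ^ 2 * p' r * (1 / ρ - 1 / r) * ρ
        = r ^ 2 * p' r - r ^ 2 * p' r * (1 / r) * ρ := by
      rw [mul_sub, sub_mul, mul_assoc (r ^ 2 * p' r) (1 / ρ), one_div_mul_cancel hρ0.ne', mul_one]
    have e2 : (p ρ - -p₀ / ρ) / (1 / ρ) = p ρ * ρ + p₀ := by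
      field_simp
      ring
    rw [e2]
    linarith)
  linarith

end Bounds

open Asymptotics in
/-- Sufficient conditions (C1)–(C3) on a pressure law
`p ∈ C³((0,∞))` with `p' > 0` (acoustic speed `c = √p'`) under which the
Riemann problem for the isentropic Euler equations is well-posed for
arbitrary sub-sonic left- and right-hand states: the Lax curves have a
unique intersection point `ρ > 0`. -/
theorem stmt19 (p p' p'' p''' : ℝ → ℝ)
    (hp' : ∀ ρ > (0 : ℝ), HasDerivAt p (p' ρ) ρ)
    (hp'' : ∀ ρ > (0 : ℝ), HasDerivAt p' (p'' ρ) ρ)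
    (hp''' : ∀ ρ > (0 : ℝ), HasDerivAt p'' (p''' ρ) ρ)
    (hp'''cont : ContinuousOn p''' (Set.Ioi 0))
    (hppos : ∀ ρ > (0 : ℝ), 0 < p' ρ)
    (hC1a : ∀ ρ > (0 : ℝ), 0 ≤ 2 * p' ρ + ρ * p'' ρ)
    (hC1b : ∀ ρ > (0 : ℝ), 0 ≤ 6 * p' ρ + 6 * ρ * p'' ρ + ρ ^ 2 * p''' ρ)
    (hC2 : Tendsto p atTop atTop ∨ ∀ ρ > (0 : ℝ), p' ρ ≤ -(p ρ / ρ))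
    (hC3 : (∃ p₀ : ℝ, 0 < p₀ ∧
        (fun ρ => p ρ - (-p₀ / ρ)) =o[𝓝[>] (0 : ℝ)] fun ρ => 1 / ρ) ∨
      ((Tendsto (fun ρ => Real.sqrt (p' ρ)) (𝓝[>] (0 : ℝ)) (𝓝 0) ∧
          ∀ ρ > (0 : ℝ), 0 ≤ 2 * p' ρ - ρ * p'' ρ) ∨
        (∃ l : ℝ, 0 < l ∧
          Tendsto (fun ρ => Real.sqrt (p' ρ)) (𝓝[>] (0 : ℝ)) (𝓝 l)) ∨
        (∃ η : ℝ, 0 < η ∧ η < 1 ∧ ∃ a : ℝ, 0 < a ∧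
          Tendsto (fun ρ => ρ ^ η * Real.sqrt (p' ρ)) (𝓝[>] (0 : ℝ)) (𝓝 a)))) :
    ∀ ρl ql ρr qr : ℝ, SubSonic p' ρl ql → SubSonic p' ρr qr →
      ∃! ρ : ℝ, 0 < ρ ∧ laxL p p' ρl ql ρ = laxR p p' ρr qr ρ := by
  have hc : ContinuousOn p' (Ioi 0) := fun x hx => (hp'' x hx).continuousAt.continuousWithinAt
  have hm := monotoneOn_sq_mul_deriv hp'' hC1a
  have hlow : ∀ {ρ₀ v : ℝ}, 0 < ρ₀ → v < Real.sqrt (p' ρ₀) →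
      ∃ ρ : ℝ, 0 < ρ ∧ v < laxVel p p' ρ₀ ρ := by
    intro ρ₀ v h₀ hv
    have hone : ∀ᶠ ρ in 𝓝[>] (0 : ℝ), ρ ∈ Ioo (0 : ℝ) 1 := Ioo_mem_nhdsGT one_pos
    rcases hC3 with ⟨p₀, hp₀, ho⟩ | ⟨hlim, hle⟩ | ⟨l, hl, hlim⟩ | ⟨η, hη, -, a, ha, hlim⟩
    · refine exists_lt_laxVel_of_le_sqrt hc (Real.sqrt_pos.mpr hp₀) ?_ h₀ v
      filter_upwards [hone] with ρ hρ
      apply Real.sqrt_le_sqrt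
      have h1 := le_sq_mul_deriv_of_isLittleO hp' hm ho hρ.1
      have h2 : ρ ^ 2 ≤ 1 := pow_le_one₀ hρ.1.le hρ.2.le
      nlinarith [hppos ρ hρ.1]
    · exact exists_lt_laxVel_of_tendsto_zero hp'' hc hppos hlim hle h₀ hv
    · exact exists_lt_laxVel_of_le_sqrt hc (half_pos hl)
        ((hlim.eventually_const_lt (half_lt_self hl)).mono fun _ h => h.le) h₀ v
    · refine exists_lt_laxVel_of_le_sqrt hc (half_pos ha) ?_ h₀ v
      filter_upwards [hone, hlim.eventually_const_lt (half_lt_self ha)] with ρ hρ hρa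
      exact hρa.le.trans (mul_le_of_le_one_left (Real.sqrt_nonneg _)
        (Real.rpow_le_one hρ.1.le hρ.2.le hη.le))
  rintro ρl ql ρr qr ⟨hl, hvl⟩ ⟨hr, hvr⟩
  have hantil := strictAntiOn_laxVel hp' hc hppos hl
  have hantir := strictAntiOn_laxVel hp' hc hppos hr
  have hanti : StrictAntiOn (fun ρ => laxVel p p' ρl ρ + laxVel p p' ρr ρ) (Ioi 0) :=
    fun x hx y hy hxy => add_lt_add (hantil hx hy hxy) (hantir hx hy hxy)
  have hcont : ContinuousOn (fun ρ => laxVel p p' ρl ρ + laxVel p p' ρr ρ) (Ioi 0) :=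
    (continuousOn_laxVel hp' hc hl).add (continuousOn_laxVel hp' hc hr)
  have hiff : ∀ ρ > (0 : ℝ), laxL p p' ρl ql ρ = laxR p p' ρr qr ρ ↔
      laxVel p p' ρl ρ + laxVel p p' ρr ρ = qr / ρr - ql / ρl := by
    intro ρ hρ
    rw [laxL_eq p p' ql hl hρ, laxR_eq p p' qr hr hρ, mul_right_inj' hρ.ne']
    constructor <;> intro h <;> linarith
  obtain ⟨a, ha, hla⟩ := hlow hl hvl
  obtain ⟨b, hb, hrb⟩ := hlow hr hvr
  obtain ⟨d, hd, hld⟩ := exists_laxVel_lt_neg hp' hppos hm hl hvl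
  obtain ⟨e, he, hre⟩ := exists_laxVel_lt_neg hp' hppos hm hr hvr
  have hmin : 0 < min a b := lt_min ha hb
  have hmax : 0 < max d e := lt_max_of_lt_left hd
  have h1 := hantil.antitoneOn hmin ha (min_le_left a b)
  have h2 := hantir.antitoneOn hmin hb (min_le_right a b)
  have h3 := hantil.antitoneOn hd hmax (le_max_left d e)
  have h4 := hantir.antitoneOn he hmax (le_max_right d e)
  obtain ⟨ρ, hρ, hρeq⟩ := isPreconnected_Ioi.intermediate_value hmax hmin hcont
    (show qr / ρr - ql / ρl ∈ Icc _ _ by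
      have := abs_le.mp (le_refl |ql / ρl|)
      have := abs_le.mp (le_refl |qr / ρr|)
      constructor <;> linarith)
  refine ⟨ρ, ⟨hρ, (hiff ρ hρ).mpr hρeq⟩, ?_⟩
  rintro σ ⟨hσ, hσeq⟩
  exact hanti.injOn hσ hρ (((hiff σ hσ).mp hσeq).trans hρeq.symm)
end
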